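/- Let a := 3^k/(3^{k-1}+1). Then: (a) for every i ≥ 1 and every J ∈ 𝐉ᵢ, w_k ≡ a^i on I(J) and σ_k ≡ a^{-(p-1)i} on I(J); for every i ≥ 0 and every K ∈ 𝐊ᵢ one has ⟨w_k⟩_K = a^i and ⟨σ_k⟩_K = (3a_{k,p}/(1−a_{k,p}))·3^{−k}·a^{−(p−1)i}, where a_{k,p} := (3^{k−1}+1)^{p−1}/3^{k(p−1)+1} satisfies 3^{−p} < a_{k,p} < 1/3. (b) There exist constants 0 < c(p) ≤ C(p), depending only on p and independent of k and of the choices of the intervals I(J), such that for all K ∈ 𝐊 with J := K^m, all K' ∈ ch_𝐊(K), and all triadic subintervals L of J not contained in any member of ch_𝐊(K): ⟨w_k⟩_L = ⟨w_k⟩_{K'} = ⟨w_k⟩_{I(J)}, c(p)⟨w_k⟩_K ≤ ⟨w_k⟩_L ≤ C(p)⟨w_k⟩_K; ⟨σ_k⟩_L = ⟨σ_k⟩_{K'}, c(p)⟨σ_k⟩_K ≤ ⟨σ_k⟩_L ≤ C(p)⟨σ_k⟩_K, c(p)3^{−k}⟨σ_k⟩_{I(J)} ≤ ⟨σ_k⟩_{K'}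 ≤ C(p)3^{−k}⟨σ_k⟩_{I(J)}; moreover c(p)3^k w_k(I(J)) ≤ w_k(K) ≤ C(p)3^k w_k(I(J)), w_k(K') = w_k(I(J)), c(p)σ_k(I(J)) ≤ σ_k(K) ≤ C(p)σ_k(I(J)), and c(p)3^k σ_k(K') ≤ σ_k(K) ≤ C(p)3^k σ_k(K'). -/

import Mathlib

open MeasureTheory Set Filter

noncomputable section

namespace RTpaper

/-- The half-open interval `[a, b)` represented by the pair `(a, b)`. -/
def ivSet (I : ℝ × ℝ) : Set ℝ := Set.Ico I.1 I.2

/-- The length of the interval represented by `I`. -/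
def len (I : ℝ × ℝ) : ℝ := I.2 - I.1

/-- The middle triadic child of an interval. -/
def mid (I : ℝ × ℝ) : ℝ × ℝ := (I.1 + (I.2 - I.1) / 3, I.2 - (I.2 - I.1) / 3)

/-- The families `𝐊ᵢ` of the Reguera–Thiele construction. -/
def Kfam (k : ℕ) : ℕ → Set (ℝ × ℝ)
  | 0 => {((0 : ℝ), (1 : ℝ))}
  | (i + 1) =>
      {I | ∃ K ∈ Kfam k i, ∃ j : ℕ, j < 3 ^ (k - 1) ∧
        I = ((mid K).1 + (j : ℝ) * ((3 : ℝ) ^ (1 - (k : ℤ)) * len (mid K)),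
             (mid K).1 + ((j : ℝ) + 1) * ((3 : ℝ) ^ (1 - (k : ℤ)) * len (mid K)))}

/-- The families `𝐉ᵢ` (of interest for `i ≥ 1`). -/
def Jfam (k i : ℕ) : Set (ℝ × ℝ) := {J | ∃ K ∈ Kfam k (i - 1), J = mid K}

/-- The family `𝐊 = ⋃ᵢ 𝐊ᵢ`. -/
def KK (k : ℕ) : Set (ℝ × ℝ) := ⋃ i, Kfam k i

/-- The family `𝐉 = ⋃_{i ≥ 1} 𝐉ᵢ`. -/
def JJ (k : ℕ) : Set (ℝ × ℝ) := ⋃ i, Jfam k (i + 1)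

/-- The chosen triadic interval `I(J)` adjacent to `J` of length `3^{1-k}|J|`, encoded by a
choice function `ch` deciding, for each `J`, whether `I(J)` lies to the right (`true`) or to
the left (`false`) of `J`. -/
def IJ (k : ℕ) (ch : ℝ × ℝ → Bool) (J : ℝ × ℝ) : ℝ × ℝ :=
  if ch J then (J.2, J.2 + (3 : ℝ) ^ (1 - (k : ℤ)) * len J)
  else (J.1 - (3 : ℝ) ^ (1 - (k : ℤ)) * len J, J.1)

/-- The weight `w_k = Σ_{i ≥ 1} Σ_{J ∈ 𝐉ᵢ} (3^k/(3^{k-1}+1))^i · 1_{I(J)}`. -/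
def wgt (k : ℕ) (ch : ℝ × ℝ → Bool) (x : ℝ) : ℝ :=
  ∑' i : ℕ, ∑' J : ↥(Jfam k (i + 1)),
    Set.indicator (ivSet (IJ k ch (J : ℝ × ℝ)))
      (fun _ => ((3 : ℝ) ^ k / ((3 : ℝ) ^ (k - 1) + 1)) ^ (i + 1)) x

/-- The weight `σ_k = w_k^{1-p}` on `{w_k > 0}`, and `0` elsewhere. -/
def sgm (p : ℝ) (k : ℕ) (ch : ℝ × ℝ → Bool) (x : ℝ) : ℝ :=
  if 0 < wgt k ch x then wgt k ch x ^ (1 - p) else 0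

/-- `u(I) = ∫_I u`. -/
def mass (u : ℝ → ℝ) (I : ℝ × ℝ) : ℝ := ∫ x in ivSet I, u x

/-- `⟨u⟩_I = u(I)/|I|`. -/
def avg (u : ℝ → ℝ) (I : ℝ × ℝ) : ℝ := mass u I / len I

/-- `ch_𝐊(K)`: the members of `𝐊_{i+1}` contained in `K ∈ 𝐊ᵢ`. -/
def chK (k : ℕ) (K : ℝ × ℝ) : Set (ℝ × ℝ) :=
  {K' | ∃ i, K ∈ Kfam k i ∧ K' ∈ Kfam k (i + 1) ∧ ivSet K' ⊆ ivSet K}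

/-- Triadic intervals of `ℝ`. -/
def IsTriadic (I : ℝ × ℝ) : Prop :=
  ∃ n j : ℤ, I.1 = (j : ℝ) * (3 : ℝ) ^ (-n) ∧ I.2 = ((j : ℝ) + 1) * (3 : ℝ) ^ (-n)

/-- Maximal members of `S` strictly contained in `R`. -/
def maxIn (S : Set (ℝ × ℝ)) (R : ℝ × ℝ) : Set (ℝ × ℝ) :=
  {Q | Q ∈ S ∧ ivSet Q ⊂ ivSet R ∧
    ∀ Q' ∈ S, ivSet Q ⊆ ivSet Q' → ivSet Q' ⊂ ivSet R → ivSet Q' = ivSet Q}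

/-- Martingale `ε`-sparse families of (half-open) intervals. -/
def MSparse (ε : ℝ) (S : Set (ℝ × ℝ)) : Prop :=
  S.Countable ∧ (∀ I ∈ S, I.1 < I.2) ∧
    (∀ I ∈ S, ∀ J ∈ S, ivSet I ⊆ ivSet J ∨ ivSet J ⊆ ivSet I ∨ ivSet I ∩ ivSet J = ∅) ∧
    ∀ R ∈ S, (∑' Q : ↥(maxIn S R), len (Q : ℝ × ℝ)) ≤ ε * len R

/-- `Σ_{I ∈ F} ⟨u⟩_I^q · ⟨v⟩_I · |I|`. -/
def sumTest (q : ℝ) (u v : ℝ → ℝ) (F : Set (ℝ × ℝ)) : ℝ :=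
  ∑' I : ↥F, avg u (I : ℝ × ℝ) ^ q * avg v (I : ℝ × ℝ) * len (I : ℝ × ℝ)


/-- The base `a = 3^k/(3^{k-1}+1)`. -/
def base (k : ℕ) : ℝ := (3 : ℝ) ^ k / ((3 : ℝ) ^ (k - 1) + 1)

/-- The constant `a_{k,p} = (3^{k-1}+1)^{p-1}/3^{k(p-1)+1}`. -/
def akp (p : ℝ) (k : ℕ) : ℝ :=
  ((3 : ℝ) ^ (k - 1) + 1) ^ (p - 1) / (3 : ℝ) ^ ((k : ℝ) * (p - 1) + 1)

/-! ### Helper material for the proof -/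

/-- The `j`-th child interval. -/
def chd (k : ℕ) (K : ℝ × ℝ) (j : ℕ) : ℝ × ℝ :=
  ((mid K).1 + (j : ℝ) * ((3 : ℝ) ^ (1 - (k : ℤ)) * len (mid K)),
   (mid K).1 + ((j : ℝ) + 1) * ((3 : ℝ) ^ (1 - (k : ℤ)) * len (mid K)))

/-- Side length at level `i`. -/
def rr (k i : ℕ) : ℝ := ((3 : ℝ) ^ (k * i))⁻¹

lemma rr_pos (k i : ℕ) : 0 < rr k i := by unfold rr; positivity

lemma rr_succ (k i : ℕ) : rr k i = 3 ^ k * rr k (i + 1) := by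
  unfold rr
  rw [mul_add, pow_add, mul_one]
  field_simp

lemma pow_k {k : ℕ} (hk : 1 ≤ k) : (3 : ℝ) ^ k = 3 * 3 ^ (k - 1) := by
  rw [← pow_succ']; congr 1; omega

lemma zpow_k (k : ℕ) : (3 : ℝ) ^ (1 - (k : ℤ)) = 3 / 3 ^ k := by
  rw [zpow_sub₀ (by norm_num)]; simp

lemma step_eq (k i : ℕ) (K : ℝ × ℝ) (h : K.2 - K.1 = rr k i) :
    (3 : ℝ) ^ (1 - (k : ℤ)) * len (mid K) = rr k (i + 1) := by
  have : len (mid K) = rr k i / 3 := by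
    simp only [len, mid]; rw [← h]; ring
  rw [this, zpow_k, rr_succ]
  field_simp

lemma K_succ {k i : ℕ} {K' : ℝ × ℝ} :
    K' ∈ Kfam k (i + 1) ↔ ∃ K ∈ Kfam k i, ∃ j : ℕ, j < 3 ^ (k - 1) ∧ K' = chd k K j := Iff.rfl

lemma chd_mem {k i : ℕ} {K : ℝ × ℝ} (hK : K ∈ Kfam k i) {j : ℕ} (hj : j < 3 ^ (k - 1)) :
    chd k K j ∈ Kfam k (i + 1) := K_succ.2 ⟨K, hK, j, hj, rfl⟩

lemma K_form {k : ℕ} (hk : 1 ≤ k) (i : ℕ) : ∀ K ∈ Kfam k i, ∃ m : ℤ,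
    K = ((m : ℝ) * rr k i, ((m : ℝ) + 1) * rr k i) := by
  induction i with
  | zero =>
    intro K hK
    refine ⟨0, ?_⟩
    have : K = (0, 1) := hK
    rw [this]; simp [rr]
  | succ i ih =>
    intro K' hK'
    obtain ⟨K, hK, j, hj, rfl⟩ := K_succ.1 hK'
    obtain ⟨m, hm⟩ := ih K hK
    have hl : K.2 - K.1 = rr k i := by rw [hm]; ring
    refine ⟨(3 * m + 1) * 3 ^ (k - 1) + j, ?_⟩
    unfold chd
    rw [step_eq k i K hl]
    have : (mid K).1 = (3 * m + 1) * 3 ^ (k - 1) * rr k (i + 1) := by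
      simp only [mid]; rw [hl, hm]; simp only; rw [rr_succ, pow_k hk]; ring
    rw [this]
    push_cast
    ext <;> simp <;> ring

lemma K_len {k : ℕ} (hk : 1 ≤ k) {i : ℕ} {K : ℝ × ℝ} (hK : K ∈ Kfam k i) :
    K.2 - K.1 = rr k i := by
  obtain ⟨m, hm⟩ := K_form hk i K hK
  rw [hm]; ring

lemma mem_grid {x r : ℝ} (hr : 0 < r) (m : ℤ) :
    x ∈ ivSet ((m : ℝ) * r, ((m : ℝ) + 1) * r) ↔ ⌊x / r⌋ = m := by
  rw [Int.floor_eq_iff, le_div_iff₀ hr, div_lt_iff₀ hr]; rfl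

lemma K_disj {k : ℕ} (hk : 1 ≤ k) {i : ℕ} {K K' : ℝ × ℝ} (hK : K ∈ Kfam k i)
    (hK' : K' ∈ Kfam k i) {x : ℝ} (hx : x ∈ ivSet K) (hx' : x ∈ ivSet K') : K = K' := by
  obtain ⟨m, rfl⟩ := K_form hk i K hK
  obtain ⟨m', rfl⟩ := K_form hk i K' hK'
  rw [mem_grid (rr_pos k i)] at hx hx'
  rw [← hx, ← hx']

lemma mid_data {k : ℕ} (hk : 1 ≤ k) {i : ℕ} {K : ℝ × ℝ} (hK : K ∈ Kfam k i) :
    (mid K).2 = (mid K).1 + 3 ^ (k - 1) * rr k (i + 1) ∧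
    K.1 + 3 ^ (k - 1) * rr k (i + 1) = (mid K).1 ∧
    (mid K).2 + 3 ^ (k - 1) * rr k (i + 1) = K.2 := by
  have hl := K_len hk hK
  have h2 := rr_succ k i
  rw [pow_k hk] at h2
  simp only [mid]
  refine ⟨?_, ?_, ?_⟩ <;> linarith

lemma chd_eq {k : ℕ} (hk : 1 ≤ k) {i : ℕ} {K : ℝ × ℝ} (hK : K ∈ Kfam k i) (j : ℕ) :
    chd k K j = ((mid K).1 + (j : ℝ) * rr k (i + 1), (mid K).1 + ((j : ℝ) + 1) * rr k (i + 1)) := by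
  unfold chd; rw [step_eq k i K (K_len hk hK)]

lemma IJ_eq {k : ℕ} (hk : 1 ≤ k) {i : ℕ} {K : ℝ × ℝ} (hK : K ∈ Kfam k i) (ch : ℝ × ℝ → Bool) :
    IJ k ch (mid K) = if ch (mid K) then ((mid K).2, (mid K).2 + rr k (i + 1))
      else ((mid K).1 - rr k (i + 1), (mid K).1) := by
  unfold IJ; rw [step_eq k i K (K_len hk hK)]

lemma one_le_N (k : ℕ) : (1 : ℝ) ≤ 3 ^ (k - 1) := one_le_pow₀ (by norm_num)

lemma IJ_sub {k : ℕ} (hk : 1 ≤ k) {i : ℕ} {K : ℝ × ℝ} (hK : K ∈ Kfam k i) (ch : ℝ × ℝ → Bool) :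
    ivSet (IJ k ch (mid K)) ⊆ ivSet K := by
  rw [IJ_eq hk hK]
  obtain ⟨h1, h2, h3⟩ := mid_data hk hK
  have hr := rr_pos k (i + 1)
  have : rr k (i + 1) ≤ 3 ^ (k - 1) * rr k (i + 1) := le_mul_of_one_le_left hr.le (one_le_N k)
  split_ifs <;> intro x hx <;> simp only [ivSet, mem_Ico] at hx ⊢ <;> constructor <;> linarith

lemma IJ_disj {k : ℕ} (hk : 1 ≤ k) {i : ℕ} {K : ℝ × ℝ} (hK : K ∈ Kfam k i) (ch : ℝ × ℝ → Bool)
    {x : ℝ} (hx : x ∈ ivSet (IJ k ch (mid K))) : x ∉ ivSet (mid K) := by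
  rw [IJ_eq hk hK] at hx
  intro h
  split_ifs at hx <;> simp only [ivSet, mem_Ico] at hx h <;> linarith [hx.1, hx.2, h.1, h.2]

lemma IJ_len {k : ℕ} (hk : 1 ≤ k) {i : ℕ} {K : ℝ × ℝ} (hK : K ∈ Kfam k i) (ch : ℝ × ℝ → Bool) :
    len (IJ k ch (mid K)) = rr k (i + 1) := by
  rw [IJ_eq hk hK]
  split_ifs <;> simp [len]

lemma mid_sub {k : ℕ} (hk : 1 ≤ k) {i : ℕ} {K : ℝ × ℝ} (hK : K ∈ Kfam k i) :
    ivSet (mid K) ⊆ ivSet K := by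
  obtain ⟨h1, h2, h3⟩ := mid_data hk hK
  have hr := rr_pos k (i + 1)
  have : 0 ≤ 3 ^ (k - 1) * rr k (i + 1) := by positivity
  intro x hx; simp only [ivSet, mem_Ico] at hx ⊢; constructor <;> linarith

lemma mem_mid {k : ℕ} (hk : 1 ≤ k) {i : ℕ} {K : ℝ × ℝ} (hK : K ∈ Kfam k i) (x : ℝ) :
    x ∈ ivSet (mid K) ↔ ∃ j : ℕ, j < 3 ^ (k - 1) ∧ x ∈ ivSet (chd k K j) := by
  obtain ⟨h1, h2, h3⟩ := mid_data hk hK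
  have hr := rr_pos k (i + 1)
  constructor
  · intro hx
    simp only [ivSet, mem_Ico] at hx
    have h0 : 0 ≤ (x - (mid K).1) / rr k (i + 1) := div_nonneg (by linarith) hr.le
    refine ⟨⌊(x - (mid K).1) / rr k (i + 1)⌋₊, ?_, ?_⟩
    · rw [Nat.floor_lt h0, div_lt_iff₀ hr]
      push_cast; linarith
    · rw [chd_eq hk hK]
      have a1 := Nat.floor_le h0
      have a2 := Nat.lt_floor_add_one ((x - (mid K).1) / rr k (i + 1))
      rw [le_div_iff₀ hr] at a1
      rw [div_lt_iff₀ hr] at a2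
      simp only [ivSet, mem_Ico]; constructor <;> linarith
  · rintro ⟨j, hj, hx⟩
    rw [chd_eq hk hK] at hx
    simp only [ivSet, mem_Ico] at hx ⊢
    have : (j : ℝ) + 1 ≤ 3 ^ (k - 1) := by exact_mod_cast hj
    have h4 := mul_le_mul_of_nonneg_right this hr.le
    have h5 : 0 ≤ (j : ℝ) * rr k (i + 1) := by positivity
    constructor <;> linarith

lemma chd_inj {k : ℕ} (hk : 1 ≤ k) {i : ℕ} {K : ℝ × ℝ} (hK : K ∈ Kfam k i) {j j' : ℕ}
    (h : chd k K j = chd k K j') : j = j' := by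
  rw [chd_eq hk hK, chd_eq hk hK] at h
  have hr := rr_pos k (i + 1)
  have := (Prod.ext_iff.1 h).1
  simp only [add_right_inj] at this
  have := mul_right_cancel₀ hr.ne' this
  exact_mod_cast this

/-- Union of level `n` intervals. -/
def UU (k n : ℕ) : Set ℝ := {x | ∃ K ∈ Kfam k n, x ∈ ivSet K}

/-- Union of level `n` intervals `I(J)`. -/
def EE (k : ℕ) (ch : ℝ × ℝ → Bool) (n : ℕ) : Set ℝ :=
  {x | ∃ K ∈ Kfam k n, x ∈ ivSet (IJ k ch (mid K))}

lemma U_succ_sub {k : ℕ} (hk : 1 ≤ k) (n : ℕ) : UU k (n + 1) ⊆ UU k n := by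
  rintro x ⟨K', hK', hx⟩
  obtain ⟨K, hK, j, hj, rfl⟩ := K_succ.1 hK'
  exact ⟨K, hK, mid_sub hk hK ((mem_mid hk hK x).2 ⟨j, hj, hx⟩)⟩

lemma U_anti {k : ℕ} (hk : 1 ≤ k) : Antitone (UU k) := antitone_nat_of_succ_le (U_succ_sub hk)

lemma E_sub_U {k : ℕ} (hk : 1 ≤ k) (ch : ℝ × ℝ → Bool) (n : ℕ) : EE k ch n ⊆ UU k n := by
  rintro x ⟨K, hK, hx⟩
  exact ⟨K, hK, IJ_sub hk hK ch hx⟩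

/-- A point of `U_{n+1}` in `K` lies in the middle of `K`. -/
lemma U_mid {k : ℕ} (hk : 1 ≤ k) {n : ℕ} {K : ℝ × ℝ} (hK : K ∈ Kfam k n) {x : ℝ}
    (hx : x ∈ ivSet K) (hU : x ∈ UU k (n + 1)) : x ∈ ivSet (mid K) := by
  obtain ⟨K', hK', hx'⟩ := hU
  obtain ⟨K₁, hK₁, j, hj, rfl⟩ := K_succ.1 hK'
  have h1 := (mem_mid hk hK₁ x).2 ⟨j, hj, hx'⟩
  have := K_disj hk hK hK₁ hx (mid_sub hk hK₁ h1)
  rwa [this]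

lemma E_disj {k : ℕ} (hk : 1 ≤ k) (ch : ℝ × ℝ → Bool) {m n : ℕ} (hmn : n < m) {x : ℝ}
    (hm : x ∈ EE k ch m) (hn : x ∈ EE k ch n) : False := by
  have hU := U_anti hk (Nat.succ_le_of_lt hmn) (E_sub_U hk ch m hm)
  obtain ⟨K, hK, hx⟩ := hn
  exact IJ_disj hk hK ch hx (U_mid hk hK (IJ_sub hk hK ch hx) hU)

lemma E_uniq {k : ℕ} (hk : 1 ≤ k) (ch : ℝ × ℝ → Bool) {m n : ℕ} {x : ℝ}
    (hm : x ∈ EE k ch m) (hn : x ∈ EE k ch n) : m = n := by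
  rcases lt_trichotomy m n with h | h | h
  · exact (E_disj hk ch h hn hm).elim
  · exact h
  · exact (E_disj hk ch h hm hn).elim

lemma E_inter {k : ℕ} (hk : 1 ≤ k) (ch : ℝ × ℝ → Bool) {n : ℕ} {K : ℝ × ℝ} (hK : K ∈ Kfam k n) :
    EE k ch n ∩ ivSet K = ivSet (IJ k ch (mid K)) := by
  ext x; constructor
  · rintro ⟨⟨K₁, hK₁, hx₁⟩, hx⟩
    rwa [K_disj hk hK hK₁ hx (IJ_sub hk hK₁ ch hx₁)]
  · intro hx
    exact ⟨⟨K, hK, hx⟩, IJ_sub hk hK ch hx⟩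

lemma K_fin (k i : ℕ) : (Kfam k i).Finite := by
  induction i with
  | zero => exact Set.finite_singleton _
  | succ i ih =>
    have : Kfam k (i + 1) ⊆ (fun q : (ℝ × ℝ) × ℕ => chd k q.1 q.2) ''
        (Kfam k i ×ˢ Set.Iio (3 ^ (k - 1))) := by
      intro K' hK'
      obtain ⟨K, hK, j, hj, rfl⟩ := K_succ.1 hK'
      exact ⟨(K, j), ⟨hK, hj⟩, rfl⟩
    exact ((ih.prod (Set.finite_Iio _)).image _).subset this

lemma iv_meas (I : ℝ × ℝ) : MeasurableSet (ivSet I) := measurableSet_Ico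

lemma E_meas (k : ℕ) (ch : ℝ × ℝ → Bool) (n : ℕ) : MeasurableSet (EE k ch n) := by
  have : EE k ch n = ⋃ K ∈ Kfam k n, ivSet (IJ k ch (mid K)) := by
    ext x; simp [EE]
  rw [this]
  exact (K_fin k n).measurableSet_biUnion fun K _ => iv_meas _

lemma iv_vol (I : ℝ × ℝ) (h : 0 ≤ len I) : volume.real (ivSet I) = len I := by
  unfold ivSet len at *
  rw [Real.volume_real_Ico_of_le (by linarith)]

lemma iv_fin (I : ℝ × ℝ) : volume (ivSet I) ≠ ⊤ := by
  unfold ivSet; simp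

lemma E_vol {k : ℕ} (hk : 1 ≤ k) (ch : ℝ × ℝ → Bool) (n : ℕ) : ∀ (i : ℕ) (K : ℝ × ℝ),
    K ∈ Kfam k i → volume.real (EE k ch (i + n) ∩ ivSet K) = (1 / 3) ^ n * rr k (i + 1) := by
  induction n with
  | zero =>
    intro i K hK
    rw [add_zero, E_inter hk ch hK, iv_vol _ (by rw [IJ_len hk hK]; exact (rr_pos _ _).le),
      IJ_len hk hK]
    simp
  | succ n ih =>
    intro i K hK
    have hset : EE k ch (i + (n + 1)) ∩ ivSet K =
        ⋃ j ∈ Finset.range (3 ^ (k - 1)), (EE k ch (i + 1 + n) ∩ ivSet (chd k K j)) := by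
      ext x
      have e : i + (n + 1) = i + 1 + n := by ring
      simp only [e, mem_inter_iff, mem_iUnion, Finset.mem_range, exists_prop]
      constructor
      · rintro ⟨hE, hx⟩
        have hU := U_anti hk (show i + 1 ≤ i + 1 + n by omega) (E_sub_U hk ch _ hE)
        obtain ⟨j, hj, hxj⟩ := (mem_mid hk hK x).1 (U_mid hk hK hx hU)
        exact ⟨j, hj, hE, hxj⟩
      · rintro ⟨j, hj, hE, hxj⟩
        exact ⟨hE, mid_sub hk hK ((mem_mid hk hK x).2 ⟨j, hj, hxj⟩)⟩
    rw [hset, measureReal_biUnion_finset ?_ ?_ ?_]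
    · rw [Finset.sum_congr rfl (fun j hj => ih (i + 1) (chd k K j)
        (chd_mem hK (Finset.mem_range.1 hj)))]
      rw [Finset.sum_const, Finset.card_range, nsmul_eq_mul, rr_succ k (i + 1), pow_k hk]
      push_cast
      ring
    · intro j hj j' hj' hne
      simp only [Finset.coe_range, mem_Iio] at hj hj'
      refine Set.disjoint_left.2 ?_
      rintro x ⟨_, hx⟩ ⟨_, hx'⟩
      exact hne (chd_inj hk hK (K_disj hk (chd_mem hK hj) (chd_mem hK hj') hx hx'))
    · intro j _
      exact (E_meas k ch _).inter (iv_meas _)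
    · intro j _
      exact ne_top_of_le_ne_top (iv_fin (chd k K j)) (measure_mono inter_subset_right)

/-- The model weight. -/
def GG (k : ℕ) (ch : ℝ × ℝ → Bool) (b : ℝ) (x : ℝ) : ℝ :=
  ∑' n : ℕ, Set.indicator (EE k ch n) (fun _ => b ^ (n + 1)) x

lemma G_on {k : ℕ} (hk : 1 ≤ k) (ch : ℝ × ℝ → Bool) (b : ℝ) {n : ℕ} {x : ℝ}
    (hx : x ∈ EE k ch n) : GG k ch b x = b ^ (n + 1) := by
  unfold GG
  rw [tsum_eq_single n]
  · rw [Set.indicator_of_mem hx]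
  · intro m hm
    exact Set.indicator_of_notMem (fun h => hm (E_uniq hk ch h hx)) _

lemma G_off {k : ℕ} (ch : ℝ × ℝ → Bool) (b : ℝ) {x : ℝ}
    (hx : ∀ n, x ∉ EE k ch n) : GG k ch b x = 0 := by
  unfold GG
  simp [Set.indicator_of_notMem (hx _)]

lemma wgt_eq {k : ℕ} (hk : 1 ≤ k) (ch : ℝ × ℝ → Bool) : wgt k ch = GG k ch (base k) := by
  funext x
  unfold wgt GG
  congr 1
  funext n
  by_cases hx : x ∈ EE k ch n
  · rw [Set.indicator_of_mem hx]
    obtain ⟨K, hK, hxK⟩ := hx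
    rw [tsum_eq_single (⟨mid K, K, hK, rfl⟩ : ↥(Jfam k (n + 1)))]
    · rw [Set.indicator_of_mem hxK]; rfl
    · rintro ⟨J, K₁, hK₁, rfl⟩ hne
      apply Set.indicator_of_notMem
      intro h
      apply hne
      have := K_disj hk hK hK₁ (IJ_sub hk hK ch hxK) (IJ_sub hk hK₁ ch h)
      subst this; rfl
  · rw [Set.indicator_of_notMem hx]
    have : ∀ J : ↥(Jfam k (n + 1)), Set.indicator (ivSet (IJ k ch (J : ℝ × ℝ)))
      (fun _ => ((3 : ℝ) ^ k / ((3 : ℝ) ^ (k - 1) + 1)) ^ (n + 1)) x = 0 := by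
      rintro ⟨J, K₁, hK₁, rfl⟩
      exact Set.indicator_of_notMem (fun h => hx ⟨K₁, hK₁, h⟩) _
    simp [this]

lemma base_bd {k : ℕ} (hk : 2 ≤ k) : 1 < base k ∧ base k < 3 := by
  unfold base
  have h := pow_k (show 1 ≤ k by omega)
  have h1 : (1 : ℝ) ≤ 3 ^ (k - 1) := one_le_N k
  constructor
  · rw [lt_div_iff₀ (by positivity)]; linarith
  · rw [div_lt_iff₀ (by positivity)]; linarith

lemma sgm_eq (p : ℝ) {k : ℕ} (hk : 2 ≤ k) (ch : ℝ × ℝ → Bool) :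
    sgm p k ch = GG k ch (base k ^ (-(p - 1))) := by
  funext x
  have hk1 : 1 ≤ k := by omega
  have hb : 0 < base k := lt_trans one_pos (base_bd hk).1
  unfold sgm
  rw [wgt_eq hk1]
  by_cases hx : ∃ n, x ∈ EE k ch n
  · obtain ⟨n, hn⟩ := hx
    rw [G_on hk1 ch _ hn, G_on hk1 ch _ hn, if_pos (by positivity), ← Real.rpow_natCast,
      ← Real.rpow_natCast, ← Real.rpow_mul hb.le, ← Real.rpow_mul hb.le]
    congr 1; ring
  · push Not at hx
    rw [G_off ch _ hx, G_off ch _ hx]; simp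

lemma ind_integral (k : ℕ) (ch : ℝ × ℝ → Bool) (n : ℕ) (c : ℝ) (K : ℝ × ℝ) :
    IntegrableOn (Set.indicator (EE k ch n) (fun _ => c)) (ivSet K) ∧
    ∫ x in ivSet K, Set.indicator (EE k ch n) (fun _ => c) x =
      volume.real (EE k ch n ∩ ivSet K) * c := by
  constructor
  · apply IntegrableOn.indicator _ (E_meas k ch n)
    exact integrableOn_const (iv_fin K)
  · rw [setIntegral_indicator (E_meas k ch n), setIntegral_const, inter_comm]; rfl

lemma G_mass {k : ℕ} (hk : 1 ≤ k) (ch : ℝ × ℝ → Bool) {b : ℝ} (hb0 : 0 < b) (hb : b < 3)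
    {i : ℕ} {K : ℝ × ℝ} (hK : K ∈ Kfam k i) :
    IntegrableOn (GG k ch b) (ivSet K) ∧
    mass (GG k ch b) K = rr k (i + 1) * b ^ (i + 1) / (1 - b / 3) := by
  set F : ℕ → ℝ → ℝ := fun n => Set.indicator (EE k ch (i + n)) (fun _ => b ^ (i + n + 1)) with hF
  have hval : ∀ n, ∫ x in ivSet K, F n x = rr k (i + 1) * b ^ (i + 1) * (b / 3) ^ n := by
    intro n
    rw [hF]
    rw [(ind_integral k ch (i + n) _ K).2, E_vol hk ch n i K hK, div_pow, div_pow]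
    ring
  have hgeo : HasSum (fun n : ℕ => rr k (i + 1) * b ^ (i + 1) * (b / 3) ^ n)
      (rr k (i + 1) * b ^ (i + 1) / (1 - b / 3)) := by
    rw [div_eq_mul_inv]
    exact (hasSum_geometric_of_lt_one (by positivity) (by linarith)).mul_left _
  have hFint : ∀ n, Integrable (F n) (volume.restrict (ivSet K)) :=
    fun n => (ind_integral k ch (i + n) _ K).1
  have hnn : ∀ n x, 0 ≤ F n x := fun n x => Set.indicator_nonneg (fun _ _ => by positivity) x
  have hnorm : ∀ n, ∫ x in ivSet K, ‖F n x‖ = rr k (i + 1) * b ^ (i + 1) * (b / 3) ^ n := by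
    intro n
    rw [← hval n]
    congr 1; funext x; exact Real.norm_of_nonneg (hnn n x)
  have hsumm : Summable fun n => ∫ x in ivSet K, ‖F n x‖ := by
    simp only [hnorm]; exact hgeo.summable
  have heq : ∀ x ∈ ivSet K, ∑' n, F n x = GG k ch b x := by
    intro x hx
    by_cases h : ∃ n, x ∈ EE k ch n
    · obtain ⟨n, hn⟩ := h
      have hin : i ≤ n := by
        by_contra hlt
        push Not at hlt
        have hU : x ∈ UU k (n + 1) := U_anti hk (show n + 1 ≤ i by omega) ⟨K, hK, hx⟩
        obtain ⟨K₁, hK₁, hx₁⟩ := hn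
        exact IJ_disj hk hK₁ ch hx₁ (U_mid hk hK₁ (IJ_sub hk hK₁ ch hx₁) hU)
      obtain ⟨m, rfl⟩ := Nat.exists_eq_add_of_le hin
      rw [G_on hk ch b hn, tsum_eq_single m]
      · exact Set.indicator_of_mem hn _
      · intro m' hm'
        refine Set.indicator_of_notMem (fun h => hm' ?_) _
        have := E_uniq hk ch h hn
        omega
    · push Not at h
      rw [G_off ch b h]
      simp [hF, Set.indicator_of_notMem (h _)]
  have hae : (fun x => ∑' n, F n x) =ᵐ[volume.restrict (ivSet K)] GG k ch b :=
    (ae_restrict_mem (iv_meas K)).mono heq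
  have hs := hasSum_integral_of_summable_integral_norm hFint hsumm
  simp only [hval] at hs
  have h1 : ∫ x in ivSet K, ∑' n, F n x = rr k (i + 1) * b ^ (i + 1) / (1 - b / 3) :=
    hs.unique hgeo
  have h2 : ∫ x in ivSet K, GG k ch b x = rr k (i + 1) * b ^ (i + 1) / (1 - b / 3) := by
    rw [← h1]; exact (integral_congr_ae hae).symm
  refine ⟨?_, h2⟩
  by_contra hni
  have h0 : ∫ x in ivSet K, GG k ch b x = 0 := integral_undef hni
  rw [h0] at h2
  have : 0 < rr k (i + 1) * b ^ (i + 1) / (1 - b / 3) :=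
    div_pos (mul_pos (rr_pos _ _) (by positivity)) (by linarith)
  linarith

lemma G_massIJ {k : ℕ} (hk : 1 ≤ k) (ch : ℝ × ℝ → Bool) (b : ℝ)
    {i : ℕ} {K : ℝ × ℝ} (hK : K ∈ Kfam k i) :
    mass (GG k ch b) (IJ k ch (mid K)) = rr k (i + 1) * b ^ (i + 1) := by
  unfold mass
  rw [setIntegral_congr_fun (g := fun _ => b ^ (i + 1)) (iv_meas _)
    (fun x hx => G_on hk ch b ⟨K, hK, hx⟩), setIntegral_const,
    iv_vol _ (by rw [IJ_len hk hK]; exact (rr_pos _ _).le), IJ_len hk hK]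
  rfl

lemma G_run {k : ℕ} (hk : 1 ≤ k) (ch : ℝ × ℝ → Bool) {b : ℝ} (hb0 : 0 < b) (hb : b < 3)
    {i : ℕ} {K : ℝ × ℝ} (hK : K ∈ Kfam k i) (α d : ℕ) (h : α + d ≤ 3 ^ (k - 1)) :
    IntegrableOn (GG k ch b)
      (Ico ((mid K).1 + α * rr k (i + 1)) ((mid K).1 + ((α + d : ℕ) : ℝ) * rr k (i + 1))) ∧
    ∫ x in Ico ((mid K).1 + α * rr k (i + 1)) ((mid K).1 + ((α + d : ℕ) : ℝ) * rr k (i + 1)),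
      GG k ch b x = d * (rr k (i + 2) * b ^ (i + 2) / (1 - b / 3)) := by
  induction d with
  | zero => simp
  | succ d ih =>
    obtain ⟨ih1, ih2⟩ := ih (by omega)
    have hc := chd_mem hK (show α + d < 3 ^ (k - 1) by omega)
    obtain ⟨g1, g2⟩ := G_mass hk ch hb0 hb hc
    unfold mass at g2
    rw [chd_eq hk hK] at g1 g2
    simp only [ivSet] at g1 g2
    have hr := rr_pos k (i + 1)
    have hU : Ico ((mid K).1 + α * rr k (i + 1)) ((mid K).1 + ((α + (d + 1) : ℕ) : ℝ) * rr k (i + 1))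
      = Ico ((mid K).1 + α * rr k (i + 1)) ((mid K).1 + ((α + d : ℕ) : ℝ) * rr k (i + 1)) ∪
        Ico ((mid K).1 + ((α + d : ℕ) : ℝ) * rr k (i + 1))
          ((mid K).1 + (((α + d : ℕ) : ℝ) + 1) * rr k (i + 1)) := by
      rw [Ico_union_Ico_eq_Ico]
      · push_cast; ring_nf
      · push_cast; nlinarith [mul_nonneg (Nat.cast_nonneg (α := ℝ) d) hr.le]
      · linarith
    rw [hU]
    refine ⟨ih1.union g1, ?_⟩
    rw [setIntegral_union _ measurableSet_Ico ih1 g1, ih2, g2]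
    · push_cast; ring
    · exact Set.disjoint_left.2 fun x hx hx' => absurd hx.2 (not_lt.2 hx'.1)

lemma L_run {k : ℕ} (hk : 1 ≤ k) {i : ℕ} {K : ℝ × ℝ} (hK : K ∈ Kfam k i) {L : ℝ × ℝ}
    (hL : L.1 < L.2) (hT : IsTriadic L) (hsub : ivSet L ⊆ ivSet (mid K))
    (hnot : ∀ j, j < 3 ^ (k - 1) → ¬ ivSet L ⊆ ivSet (chd k K j)) :
    ∃ α d : ℕ, α + d ≤ 3 ^ (k - 1) ∧ L.1 = (mid K).1 + α * rr k (i + 1) ∧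
      L.2 = (mid K).1 + ((α + d : ℕ) : ℝ) * rr k (i + 1) := by
  obtain ⟨n, q, h1, h2⟩ := hT
  have hr := rr_pos k (i + 1)
  have hrz : rr k (i + 1) = (3 : ℝ) ^ (-((k * (i + 1) : ℕ) : ℤ)) := by
    rw [zpow_neg, zpow_natCast]; rfl
  rcases le_or_gt ((k * (i + 1) : ℕ) : ℤ) n with hn | hn
  · exfalso
    obtain ⟨d, hd⟩ := Int.eq_ofNat_of_zero_le (sub_nonneg.2 hn)
    have hs : rr k (i + 1) = 3 ^ d * (3 : ℝ) ^ (-n) := by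
      rw [hrz, ← zpow_natCast, ← zpow_add₀ (by norm_num)]; congr 1; omega
    have hz : (0 : ℝ) < (3 : ℝ) ^ (-n) := by positivity
    obtain ⟨j, hj, hx⟩ := (mem_mid hk hK L.1).1 (hsub ⟨le_rfl, hL⟩)
    apply hnot j hj
    obtain ⟨m, hm⟩ := K_form hk (i + 1) _ (chd_mem hK hj)
    rw [hm] at hx ⊢
    simp only [ivSet, mem_Ico] at hx
    rw [hs, h1] at hx
    obtain ⟨hx1, hx2⟩ := hx
    have hx2' : (q : ℝ) < (m + 1) * 3 ^ d := by
      by_contra hc; push Not at hc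
      have := mul_le_mul_of_nonneg_right hc hz.le
      linarith
    have hx3 : (q : ℝ) + 1 ≤ (m + 1) * 3 ^ d := by
      have : q < (m + 1) * 3 ^ d := by exact_mod_cast hx2'
      exact_mod_cast this
    have hx4 := mul_le_mul_of_nonneg_right hx3 hz.le
    unfold ivSet
    apply Ico_subset_Ico
    · simp only; rw [hs, h1]; exact hx1
    · simp only; rw [hs, h2]; linarith
  · obtain ⟨d, hd⟩ := Int.eq_ofNat_of_zero_le (sub_nonneg.2 hn.le)
    have hs : (3 : ℝ) ^ (-n) = 3 ^ d * rr k (i + 1) := by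
      rw [hrz, ← zpow_natCast, ← zpow_add₀ (by norm_num)]; congr 1; omega
    rw [hs] at h1 h2
    obtain ⟨m, hm⟩ := K_form hk (i + 1) _ (chd_mem (j := 0) hK (by positivity))
    have hm1 : (mid K).1 = m * rr k (i + 1) := by
      rw [chd_eq hk hK] at hm
      have := (Prod.ext_iff.1 hm).1
      simpa using this
    have hm2 : (mid K).2 = (m + 3 ^ (k - 1)) * rr k (i + 1) := by
      rw [(mid_data hk hK).1, hm1]; ring
    have hs2 := (Ico_subset_Ico_iff hL).1 hsub
    rw [hm1, hm2, h1, h2, ← mul_assoc, ← mul_assoc] at hs2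
    have e1 := le_of_mul_le_mul_right hs2.1 hr
    have e2 := le_of_mul_le_mul_right hs2.2 hr
    have e1' : m ≤ q * 3 ^ d := by exact_mod_cast e1
    have e2' : (q + 1) * 3 ^ d ≤ m + 3 ^ (k - 1) := by exact_mod_cast e2
    obtain ⟨α, hα⟩ := Int.eq_ofNat_of_zero_le (sub_nonneg.2 e1')
    have hα' : (q : ℝ) * 3 ^ d = m + α := by
      have : q * 3 ^ d = m + α := by linarith
      exact_mod_cast this
    refine ⟨α, 3 ^ d, ?_, ?_, ?_⟩
    · have : (α : ℤ) + 3 ^ d ≤ 3 ^ (k - 1) := by linarith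
      exact_mod_cast this
    · rw [h1, hm1, ← mul_assoc, hα']; ring
    · rw [h2, hm1, ← mul_assoc, add_mul, hα']; push_cast; ring

lemma G_avgK {k : ℕ} (hk : 1 ≤ k) (ch : ℝ × ℝ → Bool) {b : ℝ} (hb0 : 0 < b) (hb : b < 3)
    {i : ℕ} {K : ℝ × ℝ} (hK : K ∈ Kfam k i) :
    avg (GG k ch b) K = (3 ^ k)⁻¹ * b ^ (i + 1) / (1 - b / 3) := by
  unfold avg
  rw [(G_mass hk ch hb0 hb hK).2, len, K_len hk hK, rr_succ k i]
  have := (rr_pos k (i + 1)).ne'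
  have : 1 - b / 3 ≠ 0 := by linarith
  field_simp

lemma G_avgIJ {k : ℕ} (hk : 1 ≤ k) (ch : ℝ × ℝ → Bool) (b : ℝ)
    {i : ℕ} {K : ℝ × ℝ} (hK : K ∈ Kfam k i) :
    avg (GG k ch b) (IJ k ch (mid K)) = b ^ (i + 1) := by
  unfold avg
  rw [G_massIJ hk ch b hK, IJ_len hk hK]
  have := (rr_pos k (i + 1)).ne'
  field_simp

lemma G_avgL {k : ℕ} (hk : 1 ≤ k) (ch : ℝ × ℝ → Bool) {b : ℝ} (hb0 : 0 < b) (hb : b < 3)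
    {i : ℕ} {K : ℝ × ℝ} (hK : K ∈ Kfam k i) {L : ℝ × ℝ}
    (hL : L.1 < L.2) (hT : IsTriadic L) (hsub : ivSet L ⊆ ivSet (mid K))
    (hnot : ∀ j, j < 3 ^ (k - 1) → ¬ ivSet L ⊆ ivSet (chd k K j)) :
    avg (GG k ch b) L = (3 ^ k)⁻¹ * b ^ (i + 2) / (1 - b / 3) := by
  obtain ⟨α, d, h, h1, h2⟩ := L_run hk hK hL hT hsub hnot
  have hI := (G_run hk ch hb0 hb hK α d h).2
  have hlen : len L = d * rr k (i + 1) := by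
    unfold len; rw [h1, h2]; push_cast; ring
  have hd : (d : ℝ) ≠ 0 := by
    intro h0
    rw [len, h0] at hlen; linarith
  unfold avg mass ivSet
  rw [hlen, h1, h2, hI, rr_succ k (i + 1)]
  have := (rr_pos k (i + 2)).ne'
  have : 1 - b / 3 ≠ 0 := by linarith
  field_simp

lemma akp_eq (p : ℝ) (k : ℕ) : akp p k = base k ^ (-(p - 1)) / 3 := by
  unfold akp base
  rw [Real.rpow_add (by norm_num), Real.rpow_mul (by norm_num), Real.rpow_one, Real.rpow_natCast,
    Real.rpow_neg (by positivity), Real.div_rpow (by positivity) (by positivity)]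
  field_simp

lemma b_bd {p : ℝ} (hp : 1 < p) {k : ℕ} (hk : 2 ≤ k) :
    (3 : ℝ) ^ (-p) * 3 < base k ^ (-(p - 1)) ∧ base k ^ (-(p - 1)) < 1 := by
  obtain ⟨h1, h2⟩ := base_bd hk
  constructor
  · have : (3 : ℝ) ^ (-p) * 3 = 3 ^ (-(p - 1)) := by
      rw [show -(p - 1) = -p + 1 by ring, Real.rpow_add (by norm_num), Real.rpow_one]
    rw [this]
    exact Real.rpow_lt_rpow_of_neg (by linarith) h2 (by linarith)
  · exact Real.rpow_lt_one_of_one_lt_of_neg h1 (by linarith)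

lemma base_id {k : ℕ} (hk : 1 ≤ k) : (3 ^ k)⁻¹ * base k / (1 - base k / 3) = 1 := by
  have h : (1 : ℝ) - base k / 3 = 1 / (3 ^ (k - 1) + 1) := by
    unfold base; rw [pow_k hk]; field_simp; ring
  rw [h]; unfold base; field_simp

/-- Lemma 3.1 of the paper: exact values of `w_k`, `σ_k` and of their averages on the
triadic intervals of the construction, together with the comparison estimates of part (b). -/
theorem statement0 (p : ℝ) (hp : 1 < p) :
    (∀ k : ℕ, 3000 < k → ∀ ch : ℝ × ℝ → Bool,
      (∀ i : ℕ, 1 ≤ i → ∀ J ∈ Jfam k i, ∀ x ∈ ivSet (IJ k ch J),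
          wgt k ch x = base k ^ i ∧
          sgm p k ch x = base k ^ (-(p - 1) * (i : ℝ))) ∧
      ((3 : ℝ) ^ (-p) < akp p k ∧ akp p k < 1 / 3) ∧
      (∀ i : ℕ, ∀ K ∈ Kfam k i,
          avg (wgt k ch) K = base k ^ i ∧
          avg (sgm p k ch) K =
            3 * akp p k / (1 - akp p k) * (3 : ℝ) ^ (-(k : ℤ)) *
              base k ^ (-(p - 1) * (i : ℝ)))) ∧
    (∃ c C : ℝ, 0 < c ∧ c ≤ C ∧ ∀ k : ℕ, 3000 < k → ∀ ch : ℝ × ℝ → Bool,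
      ∀ K ∈ KK k, ∀ K' ∈ chK k K, ∀ L : ℝ × ℝ, L.1 < L.2 → IsTriadic L →
        ivSet L ⊆ ivSet (mid K) → (∀ K'' ∈ chK k K, ¬ ivSet L ⊆ ivSet K'') →
        (avg (wgt k ch) L = avg (wgt k ch) K' ∧
         avg (wgt k ch) K' = avg (wgt k ch) (IJ k ch (mid K)) ∧
         c * avg (wgt k ch) K ≤ avg (wgt k ch) L ∧
         avg (wgt k ch) L ≤ C * avg (wgt k ch) K ∧
         avg (sgm p k ch) L = avg (sgm p k ch) K' ∧
         c * avg (sgm p k ch) K ≤ avg (sgm p k ch) L ∧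
         avg (sgm p k ch) L ≤ C * avg (sgm p k ch) K ∧
         c * ((3 : ℝ) ^ (-(k : ℤ)) * avg (sgm p k ch) (IJ k ch (mid K))) ≤
            avg (sgm p k ch) K' ∧
         avg (sgm p k ch) K' ≤
            C * ((3 : ℝ) ^ (-(k : ℤ)) * avg (sgm p k ch) (IJ k ch (mid K))) ∧
         c * ((3 : ℝ) ^ k * mass (wgt k ch) (IJ k ch (mid K))) ≤ mass (wgt k ch) K ∧
         mass (wgt k ch) K ≤ C * ((3 : ℝ) ^ k * mass (wgt k ch) (IJ k ch (mid K))) ∧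
         mass (wgt k ch) K' = mass (wgt k ch) (IJ k ch (mid K)) ∧
         c * mass (sgm p k ch) (IJ k ch (mid K)) ≤ mass (sgm p k ch) K ∧
         mass (sgm p k ch) K ≤ C * mass (sgm p k ch) (IJ k ch (mid K)) ∧
         c * ((3 : ℝ) ^ k * mass (sgm p k ch) K') ≤ mass (sgm p k ch) K ∧
         mass (sgm p k ch) K ≤ C * ((3 : ℝ) ^ k * mass (sgm p k ch) K'))) := by
  constructor
  · intro k hk ch
    have hk2 : 2 ≤ k := by omega
    have hk1 : 1 ≤ k := by omega
    obtain ⟨a1, a2⟩ := base_bd hk2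
    obtain ⟨b1, b2⟩ := b_bd hp hk2
    have a0 : 0 < base k := by linarith
    have b0 : 0 < base k ^ (-(p - 1)) := Real.rpow_pos_of_pos a0 _
    refine ⟨?_, ⟨?_, ?_⟩, ?_⟩
    · rintro i hi J ⟨K, hK, rfl⟩ x hx
      rw [sgm_eq p hk2, wgt_eq hk1]
      have hE : x ∈ EE k ch (i - 1) := ⟨K, hK, hx⟩
      rw [G_on hk1 ch _ hE, G_on hk1 ch _ hE, Real.rpow_mul_natCast a0.le, Nat.sub_add_cancel hi]
      exact ⟨rfl, rfl⟩
    · rw [akp_eq]; linarith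
    · rw [akp_eq]; linarith
    · intro i K hK
      rw [sgm_eq p hk2, wgt_eq hk1, G_avgK hk1 ch a0 a2 hK, G_avgK hk1 ch b0 (by linarith) hK,
        akp_eq, Real.rpow_mul_natCast a0.le, zpow_neg, zpow_natCast]
      constructor
      · calc _ = (3 ^ k)⁻¹ * base k / (1 - base k / 3) * base k ^ i := by ring
          _ = _ := by rw [base_id hk1, one_mul]
      · ring
  · have hp3 : (3 : ℝ) ≤ 3 ^ p := by
      calc (3 : ℝ) = 3 ^ (1 : ℝ) := (Real.rpow_one 3).symm
        _ ≤ 3 ^ p := Real.rpow_le_rpow_of_exponent_le (by norm_num) hp.le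
    have hc0 : (0 : ℝ) < 3 ^ (-p) := by positivity
    have hc1 : (3 : ℝ) ^ (-p) ≤ 1 / 3 := by
      rw [Real.rpow_neg (by norm_num), one_div]
      exact inv_anti₀ (by norm_num) hp3
    have hcC : (3 : ℝ) ^ (-p) * 3 ^ p = 1 := by
      rw [← Real.rpow_add (by norm_num)]; simp
    refine ⟨(3 : ℝ) ^ (-p), (3 : ℝ) ^ p, hc0, by linarith, ?_⟩
    intro k hk ch K _ K' hK'c L hL hT hsub hnot
    obtain ⟨i, hK, hK', -⟩ := hK'c
    have hk2 : 2 ≤ k := by omega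
    have hk1 : 1 ≤ k := by omega
    obtain ⟨a1, a2⟩ := base_bd hk2
    obtain ⟨b1, b2⟩ := b_bd hp hk2
    have a0 : 0 < base k := by linarith
    have b0 : 0 < base k ^ (-(p - 1)) := Real.rpow_pos_of_pos a0 _
    have hnot' : ∀ j, j < 3 ^ (k - 1) → ¬ ivSet L ⊆ ivSet (chd k K j) := fun j hj =>
      hnot _ ⟨i, hK, chd_mem hK hj, fun x hx => mid_sub hk1 hK ((mem_mid hk1 hK x).2 ⟨j, hj, hx⟩)⟩
    have hid := base_id hk1
    rw [sgm_eq p hk2, wgt_eq hk1]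
    set a := base k
    set b := a ^ (-(p - 1))
    set c := (3 : ℝ) ^ (-p)
    set C := (3 : ℝ) ^ p
    have b3 : b < 3 := by linarith
    rw [G_avgK hk1 ch a0 a2 hK, G_avgK hk1 ch b0 b3 hK, G_avgK hk1 ch a0 a2 hK',
      G_avgK hk1 ch b0 b3 hK', G_avgL hk1 ch a0 a2 hK hL hT hsub hnot',
      G_avgL hk1 ch b0 b3 hK hL hT hsub hnot', G_avgIJ hk1 ch a hK, G_avgIJ hk1 ch b hK,
      (G_mass hk1 ch a0 a2 hK).2, (G_mass hk1 ch b0 b3 hK).2, (G_mass hk1 ch a0 a2 hK').2,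
      (G_mass hk1 ch b0 b3 hK').2, G_massIJ hk1 ch a hK, G_massIJ hk1 ch b hK, zpow_neg,
      zpow_natCast, rr_succ k (i + 1)]
    set N : ℝ := 3 ^ k
    set r := rr k (i + 1 + 1)
    have hN : 0 < N := by positivity
    have hr : 0 < r := rr_pos _ _
    have hA : a / (1 - a / 3) = N := by
      have : a / (1 - a / 3) = N * (N⁻¹ * a / (1 - a / 3)) := by field_simp
      rw [this, hid, mul_one]
    set D := (1 - b / 3)⁻¹ with hD
    have hD0 : 0 < 1 - b / 3 := by linarith
    have hD1 : 1 ≤ D := (one_le_inv₀ hD0).2 (by linarith)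
    have hD2 : D ≤ 3 / 2 := by
      rw [hD, inv_le_comm₀ hD0 (by norm_num)]; linarith
    have hai : 0 < a ^ i := by positivity
    have hbi : 0 < b ^ i := by positivity
    have w0 : N⁻¹ * a ^ (i + 1) / (1 - a / 3) = a ^ i := by
      calc _ = N⁻¹ * a / (1 - a / 3) * a ^ i := by ring
        _ = _ := by rw [hid, one_mul]
    have w1 : N⁻¹ * a ^ (i + 2) / (1 - a / 3) = a * a ^ i := by
      calc _ = N⁻¹ * a / (1 - a / 3) * (a * a ^ i) := by ring
        _ = _ := by rw [hid, one_mul]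
    have w2 : N * r * a ^ (i + 1) / (1 - a / 3) = N * r * N * a ^ i := by
      calc _ = N * r * (a / (1 - a / 3)) * a ^ i := by ring
        _ = _ := by rw [hA]
    have w3 : r * a ^ (i + 1 + 1) / (1 - a / 3) = N * r * a ^ (i + 1) := by
      calc _ = r * (a / (1 - a / 3)) * a ^ (i + 1) := by ring
        _ = _ := by rw [hA]; ring
    have s0 : ∀ n, N⁻¹ * b ^ n / (1 - b / 3) = N⁻¹ * b ^ n * D := fun n => div_eq_mul_inv _ _
    have s1 : N * r * b ^ (i + 1) / (1 - b / 3) = N * r * b ^ (i + 1) * D := div_eq_mul_inv _ _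
    have s2 : r * b ^ (i + 1 + 1) / (1 - b / 3) = r * b ^ (i + 1 + 1) * D := div_eq_mul_inv _ _
    have hcb : c ≤ b := by linarith
    have key : ∀ {x y z : ℝ}, 0 ≤ z → x ≤ y → x * z ≤ y * z :=
      fun hz h => mul_le_mul_of_nonneg_right h hz
    have hP : 0 ≤ N⁻¹ * b ^ (i + 1) * D := by positivity
    have hQ : 0 ≤ N⁻¹ * b ^ (i + 1) := by positivity
    have hR : 0 ≤ N * r * b ^ (i + 1) := by positivity
    have hS : 0 ≤ N * r * b ^ (i + 1) * D := by positivity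
    have hW : 0 ≤ N * r * N * a ^ i := by positivity
    have hbD : c ≤ b * D := hcb.trans (le_mul_of_one_le_right b0.le hD1)
    have hbD' : b * D ≤ 3 :=
      (mul_le_mul b2.le hD2 (by linarith) zero_le_one).trans (by norm_num)
    have hca : c * a ≤ 1 :=
      (mul_le_mul hc1 a2.le a0.le (by norm_num)).trans (by norm_num)
    have hcb1 : c * b ≤ 1 :=
      (mul_le_mul hc1 b2.le b0.le (by norm_num)).trans (by norm_num)
    have hCb : 1 ≤ C * b := by
      have := key (show 0 ≤ C by linarith) hcb
      linarith
    have hCa : 1 ≤ C * a :=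
      one_le_mul_of_one_le_of_one_le (by linarith) a1.le
    rw [s0, s0, s1, s2, w0, w2, w3, show i + 1 + 1 = i + 2 from rfl, w1]
    refine ⟨rfl, by ring, key hai.le (by linarith), key hai.le (by linarith), rfl, ?_, ?_, ?_, ?_,
      ?_, ?_, rfl, ?_, ?_, ?_, ?_⟩
    · linear_combination key hP hcb
    · linear_combination key hP (show b ≤ C by linarith)
    · linear_combination key hQ hbD
    · linear_combination key hQ (show b * D ≤ C by linarith)
    · linear_combination key hW hca
    · linear_combination key hW hCa
    · linear_combination key hR (show c ≤ D by linarith)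
    · linear_combination key hR (show D ≤ C by linarith)
    · linear_combination key hS hcb1
    · linear_combination key hS hCb

end RTpaper
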